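/- Let 𝒫 be a nonempty set of probability measures on a measurable space (Ω, ℱ), let A, B ∈ ℱ, and assume P(B) > 0 for every P ∈ 𝒫. Suppose there exists P₀ ∈ 𝒫 with P₀(A) = P̲(A) and P₀(A ∩ B) < P₀(A) · P₀(B), and there exists P₁ ∈ 𝒫 with P₁(A) = P̄(A) and P₁(A ∩ B) > P₁(A) · P₁(B). Then ⨅_{P∈𝒫} P(A|B) < P̲(A) and ⨆_{P∈𝒫} P(A|B) > P̄(A); that is, conditioning on B strictly dilates A, so intentionally forgetting B strictly constricts A. -/

import Mathlib

open MeasureTheory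

/-- The conditional probability `P(A | B) = P(A ∩ B) / P(B)` as a real number. -/
noncomputable def condProb {Ω : Type*} [MeasurableSpace Ω]
    (P : MeasureTheory.Measure Ω) (A B : Set Ω) : ℝ :=
  (P (A ∩ B)).toReal / (P B).toReal

/-- The lower probability of `A` for a set of probability measures `Ps`. -/
noncomputable def lowerProb {Ω : Type*} [MeasurableSpace Ω]
    (Ps : Set (MeasureTheory.Measure Ω)) (A : Set Ω) : ℝ :=
  ⨅ P : Ps, (P.1 A).toReal

/-- The upper probability of `A` for a set of probability measures `Ps`. -/
noncomputable def upperProb {Ω : Type*} [MeasurableSpace Ω]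
    (Ps : Set (MeasureTheory.Measure Ω)) (A : Set Ω) : ℝ :=
  ⨆ P : Ps, (P.1 A).toReal

theorem condProb_nonneg {Ω : Type*} [MeasurableSpace Ω] (P : Measure Ω) (A B : Set Ω) :
    0 ≤ condProb P A B :=
  div_nonneg ENNReal.toReal_nonneg ENNReal.toReal_nonneg

theorem condProb_le_one {Ω : Type*} [MeasurableSpace Ω] (P : Measure Ω) [IsFiniteMeasure P]
    (A B : Set Ω) : condProb P A B ≤ 1 :=
  div_le_one_of_le₀ (measureReal_mono Set.inter_subset_right) ENNReal.toReal_nonneg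

/-- if the lower probability of `A` is attained by some `P₀ ∈ Ps` that is
negatively correlated on `(A, B)`, and the upper probability is attained by some `P₁ ∈ Ps`
that is positively correlated on `(A, B)`, then conditioning on `B` strictly dilates `A`
(so intentionally forgetting `B` strictly constricts `A`). -/
theorem forgetting_constricts_of_dilation {Ω : Type*} [MeasurableSpace Ω]
    (Ps : Set (Measure Ω)) (hPsne : Ps.Nonempty)
    (hPsprob : ∀ P ∈ Ps, IsProbabilityMeasure P)
    {A B : Set Ω} (hA : MeasurableSet A) (hB : MeasurableSet B)
    (hBpos : ∀ P ∈ Ps, 0 < P B)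
    (hlow : ∃ P₀ ∈ Ps, (P₀ A).toReal = lowerProb Ps A ∧
        (P₀ (A ∩ B)).toReal < (P₀ A).toReal * (P₀ B).toReal)
    (hup : ∃ P₁ ∈ Ps, (P₁ A).toReal = upperProb Ps A ∧
        (P₁ A).toReal * (P₁ B).toReal < (P₁ (A ∩ B)).toReal) :
    (⨅ P : Ps, condProb P.1 A B) < lowerProb Ps A ∧
      upperProb Ps A < ⨆ P : Ps, condProb P.1 A B := by
  have toReal_pos : ∀ P ∈ Ps, 0 < (P B).toReal := fun P hP ↦
    have := hPsprob P hP
    ENNReal.toReal_pos (hBpos P hP).ne' (measure_ne_top P B)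
  obtain ⟨P₀, hP₀, h₀, hneg⟩ := hlow
  obtain ⟨P₁, hP₁, h₁, hpos⟩ := hup
  constructor
  · have hbdd : BddBelow (Set.range fun P : Ps ↦ condProb P.1 A B) :=
      ⟨0, Set.forall_mem_range.2 fun P ↦ condProb_nonneg P.1 A B⟩
    rw [← h₀]
    exact (ciInf_le hbdd ⟨P₀, hP₀⟩).trans_lt ((div_lt_iff₀ (toReal_pos P₀ hP₀)).2 hneg)
  · have hbdd : BddAbove (Set.range fun P : Ps ↦ condProb P.1 A B) :=
      ⟨1, Set.forall_mem_range.2 fun P ↦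
        have := hPsprob P.1 P.2
        condProb_le_one P.1 A B⟩
    rw [← h₁]
    exact ((lt_div_iff₀ (toReal_pos P₁ hP₁)).2 hpos).trans_le (le_ciSup hbdd ⟨P₁, hP₁⟩)
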